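/- For any θ ∈ (0, π) and any T₁, T₂ > 0 with T₁ + T₂ < 2θ, there exists a unique (up to isometry) spherical bigon of angle θ whose two sides have total geodesic curvatures T₁ and T₂. -/

import Mathlib

open Real

/-- Inverse cotangent, with values in `(0, π)`. -/
noncomputable def arccot (x : ℝ) : ℝ := π / 2 - Real.arctan x

/-- The radius `r ∈ (0, π/2)` of a disk with parameter `K = log cot r`, i.e. `r = arccot (e^K)`. -/
noncomputable def radiusOf (K : ℝ) : ℝ := arccot (Real.exp K)

/-- The total geodesic curvature `T₁ = k₁ ℓ₁ = 2 α₁' cos r₁` of the first side of the spherical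
bigon of angle `θ` with parameters `(K₁, K₂)`, where `r_i = arccot (e^{K_i})` and the half-angle
`α₁'` is given by the cotangent four-part formula. -/
noncomputable def T₁ (θ K₁ K₂ : ℝ) : ℝ :=
  2 * arccot ((Real.exp K₂ * Real.sin (radiusOf K₁) -
      Real.cos (radiusOf K₁) * Real.cos (π - θ)) / Real.sin (π - θ)) *
    Real.cos (radiusOf K₁)

/-- The total geodesic curvature of the second side, obtained by swapping the sides. -/
noncomputable def T₂ (θ K₁ K₂ : ℝ) : ℝ := T₁ θ K₂ K₁

lemma arccot_pos (u : ℝ) : 0 < arccot u := by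
  have := Real.arctan_lt_pi_div_two u
  unfold arccot
  linarith

lemma continuous_arccot : Continuous arccot :=
  continuous_const.sub Real.continuous_arctan

lemma arccot_strictAnti : StrictAnti arccot := fun _ _ h =>
  sub_lt_sub_left (Real.arctan_strictMono h) _

lemma arccot_cos_div_sin {φ : ℝ} (h₀ : 0 < φ) (h₁ : φ < π) :
    arccot (Real.cos φ / Real.sin φ) = φ := by
  have h : Real.cos φ / Real.sin φ = Real.tan (π / 2 - φ) := by
    rw [Real.tan_eq_sin_div_cos, Real.sin_pi_div_two_sub, Real.cos_pi_div_two_sub]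
  rw [arccot, h, Real.arctan_tan (by linarith) (by linarith)]
  ring

lemma div_one_add_sq_lt_arccot (u : ℝ) : u / (1 + u ^ 2) < arccot u := by
  have hu := Real.tan_arctan u
  have hlt := Real.arctan_lt_pi_div_two u
  have hc := Real.cos_arctan_pos u
  unfold arccot
  set a := Real.arctan u
  have h : u / (1 + u ^ 2) = Real.sin (π - 2 * a) / 2 := by
    have h1 := Real.inv_one_add_tan_sq hc.ne'
    rw [hu] at h1
    rw [Real.sin_pi_sub, Real.sin_two_mul, div_eq_mul_inv, h1, ← hu, Real.tan_eq_sin_div_cos]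
    field_simp
  have := Real.sin_lt (x := π - 2 * a) (by linarith)
  rw [h]
  linarith

/-- The total geodesic curvature of the first side of the bigon of angle `θ` whose sides have
geodesic curvatures `x` and `y`. -/
noncomputable def sideCurvature (θ x y : ℝ) : ℝ :=
  2 * arccot ((y + x * Real.cos θ) / (√(1 + x ^ 2) * Real.sin θ)) * (x / √(1 + x ^ 2))

lemma T₁_eq_sideCurvature (θ K₁ K₂ : ℝ) :
    T₁ θ K₁ K₂ = sideCurvature θ (Real.exp K₁) (Real.exp K₂) := by
  have hs : √(1 + Real.exp K₁ ^ 2) ≠ 0 := by positivity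
  have hsin : Real.sin (radiusOf K₁) = 1 / √(1 + Real.exp K₁ ^ 2) := by
    rw [radiusOf, arccot, Real.sin_pi_div_two_sub, Real.cos_arctan]
  have hcos : Real.cos (radiusOf K₁) = Real.exp K₁ / √(1 + Real.exp K₁ ^ 2) := by
    rw [radiusOf, arccot, Real.cos_pi_div_two_sub, Real.sin_arctan]
  rw [T₁, sideCurvature, hsin, hcos, Real.cos_pi_sub, Real.sin_pi_sub]
  congr 3
  rw [← div_div]
  congr 1
  field_simp
  ring

lemma sideCurvature_strictAnti_right {θ x : ℝ} (hS : 0 < Real.sin θ) (hx : 0 < x) :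
    StrictAnti (sideCurvature θ x) := by
  intro y y' h
  have hs : 0 < √(1 + x ^ 2) := by positivity
  unfold sideCurvature
  have := @arccot_strictAnti ((y + x * Real.cos θ) / (√(1 + x ^ 2) * Real.sin θ))
    ((y' + x * Real.cos θ) / (√(1 + x ^ 2) * Real.sin θ)) (by gcongr)
  gcongr

lemma hasDerivAt_sideCurvature_add {θ : ℝ} (hS : 0 < Real.sin θ) (x y : ℝ) :
    HasDerivAt (fun x => sideCurvature θ x y + sideCurvature θ y x)
      (2 / √(1 + x ^ 2) ^ 3 *
        (arccot ((y + x * Real.cos θ) / (√(1 + x ^ 2) * Real.sin θ)) -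
          ((y + x * Real.cos θ) / (√(1 + x ^ 2) * Real.sin θ)) /
            (1 + ((y + x * Real.cos θ) / (√(1 + x ^ 2) * Real.sin θ)) ^ 2))) x := by
  have hx1 : (0 : ℝ) < 1 + x ^ 2 := by positivity
  have hy1 : (0 : ℝ) < 1 + y ^ 2 := by positivity
  have hsq : HasDerivAt (fun x : ℝ => √(1 + x ^ 2)) (x / √(1 + x ^ 2)) x := by
    refine (((hasDerivAt_pow 2 x).const_add 1).sqrt hx1.ne').congr_deriv ?_
    norm_num
    field_simp
  have hs : 0 < √(1 + x ^ 2) := by positivity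
  have ht : 0 < √(1 + y ^ 2) := by positivity
  have hs2 : √(1 + x ^ 2) ^ 2 = 1 + x ^ 2 := Real.sq_sqrt hx1.le
  have ht2 : √(1 + y ^ 2) ^ 2 = 1 + y ^ 2 := Real.sq_sqrt hy1.le
  have hu := (((hasDerivAt_id x).mul_const (Real.cos θ)).const_add y).div
    (hsq.mul_const (Real.sin θ)) (by positivity)
  have hv := ((hasDerivAt_id x).add_const (y * Real.cos θ)).div_const
    (√(1 + y ^ 2) * Real.sin θ)
  have h1 := ((hu.arctan.const_sub (π / 2)).const_mul 2).mul ((hasDerivAt_id x).div hsq hs.ne')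
  have h2 := ((hv.arctan.const_sub (π / 2)).const_mul 2).mul_const (y / √(1 + y ^ 2))
  refine (h1.add h2).congr_deriv ?_
  simp only [id, arccot, Pi.div_apply]
  have hSC := Real.sin_sq_add_cos_sq θ
  generalize √(1 + x ^ 2) = s at *
  generalize √(1 + y ^ 2) = t at *
  generalize Real.sin θ = S at *
  generalize Real.cos θ = c at *
  generalize Real.arctan _ = a
  have hD : 0 < (s * S) ^ 2 + (y + x * c) ^ 2 := by positivity
  have hE : (t * S) ^ 2 + (x + y * c) ^ 2 = (s * S) ^ 2 + (y + x * c) ^ 2 := by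
    linear_combination S ^ 2 * ht2 - S ^ 2 * hs2 + (y ^ 2 - x ^ 2) * hSC
  have e1 : 1 + ((y + x * c) / (s * S)) ^ 2
      = ((s * S) ^ 2 + (y + x * c) ^ 2) / (s * S) ^ 2 := by field_simp
  have e2 : 1 + ((x + y * c) / (t * S)) ^ 2
      = ((s * S) ^ 2 + (y + x * c) ^ 2) / (t * S) ^ 2 := by rw [← hE]; field_simp
  rw [e1, e2]
  generalize (s * S) ^ 2 + (y + x * c) ^ 2 = D at *
  field_simp
  linear_combination (D * (π - 2 * a) - 2 * s * S * x * c - 2 * s * S * y) * hs2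

lemma sideCurvature_add_strictMono {θ : ℝ} (hS : 0 < Real.sin θ) (y : ℝ) :
    StrictMono (fun x => sideCurvature θ x y + sideCurvature θ y x) := by
  refine strictMono_of_hasDerivAt_pos (fun x => hasDerivAt_sideCurvature_add hS x y) fun x => ?_
  exact mul_pos (by positivity) (sub_pos.2 (div_one_add_sq_lt_arccot _))

lemma sideCurvature_strictMono_left {θ y : ℝ} (hS : 0 < Real.sin θ) (hy : 0 < y) :
    StrictMono (fun x => sideCurvature θ x y) := by
  intro x x' h
  have h1 := sideCurvature_add_strictMono hS y h
  have h2 := sideCurvature_strictAnti_right hS hy h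
  dsimp only at h1 ⊢
  linarith

lemma sideCurvature_injective {θ x y x' y' : ℝ} (hS : 0 < Real.sin θ)
    (hx : 0 < x) (hy : 0 < y) (hx' : 0 < x') (hy' : 0 < y')
    (h₁ : sideCurvature θ x y = sideCurvature θ x' y')
    (h₂ : sideCurvature θ y x = sideCurvature θ y' x') : x = x' ∧ y = y' := by
  wlog hxx : x ≤ x' generalizing x y x' y'
  · exact (this hx' hy' hx hy h₁.symm h₂.symm (le_of_not_ge hxx)).imp Eq.symm Eq.symm
  have A1 := (sideCurvature_add_strictMono hS y).monotone hxx
  have A2 := (sideCurvature_strictMono_left hS hy).monotone hxx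
  rcases lt_trichotomy y y' with hyy | hyy | hyy
  · have := sideCurvature_add_strictMono hS x' hyy
    dsimp only at this
    linarith
  · subst hyy
    exact ⟨(sideCurvature_strictMono_left hS hy).injective h₁, rfl⟩
  · have := sideCurvature_strictAnti_right hS hx' hyy
    linarith

lemma exists_sideCurvature_eq {θ t₁ t₂ : ℝ} (hθ : θ ∈ Set.Ioo 0 π)
    (ht₁ : 0 < t₁) (ht₂ : 0 < t₂) (hsum : t₁ + t₂ < 2 * θ) :
    ∃ x y : ℝ, 0 < x ∧ 0 < y ∧ sideCurvature θ x y = t₁ ∧ sideCurvature θ y x = t₂ := by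
  obtain ⟨hθ0, hθπ⟩ := hθ
  have hS : 0 < Real.sin θ := Real.sin_pos_of_pos_of_lt_pi hθ0 hθπ
  -- parametrize the level set of the first curvature by the half-angle `φ` of the first side
  let p : ℝ → ℝ := fun φ => t₁ / (2 * φ)
  let M : ℝ → ℝ := fun φ => Real.sin θ * Real.cos φ - p φ * Real.cos θ * Real.sin φ
  let W : ℝ → ℝ := fun φ => (1 - p φ ^ 2) * Real.sin φ ^ 2 + M φ ^ 2
  let h : ℝ → ℝ := fun φ =>
    2 * arccot ((p φ * Real.sin φ + M φ * Real.cos θ) / (√(W φ) * Real.sin θ)) *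
      (M φ / √(W φ))
  have hp0 : ∀ φ, t₁ / 2 ≤ φ → 0 < p φ := fun φ hφ => by
    have : 0 < φ := by linarith
    positivity
  have hp1 : ∀ φ, t₁ / 2 < φ → p φ < 1 := fun φ hφ => by
    rw [div_lt_one (by linarith)]
    linarith
  have hp_left : p (t₁ / 2) = 1 := by
    simp only [p]
    field_simp
  have hM_left : M (t₁ / 2) = Real.sin (θ - t₁ / 2) := by
    simp only [M, hp_left, Real.sin_sub]
    ring
  have hM_left_pos : 0 < M (t₁ / 2) := by
    rw [hM_left]
    exact Real.sin_pos_of_pos_of_lt_pi (by linarith) (by linarith)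
  have hM_right : M π = -Real.sin θ := by simp [M]
  have hW_pos : ∀ φ ∈ Set.Icc (t₁ / 2) π, 0 < W φ := by
    rintro φ ⟨hl, hr⟩
    rcases hl.eq_or_lt with rfl | hl
    · simp only [W, hp_left]
      nlinarith
    rcases hr.eq_or_lt with rfl | hr
    · simp only [W, hM_right, Real.sin_pi]
      nlinarith
    · have h1 := Real.sin_pos_of_pos_of_lt_pi (by linarith : 0 < φ) hr
      have h2 : 0 < 1 - p φ ^ 2 := by nlinarith [hp0 φ hl.le, hp1 φ hl]
      have := mul_pos h2 (pow_pos h1 2)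
      have := sq_nonneg (M φ)
      simp only [W]
      linarith
  have hp_cont : ContinuousOn p (Set.Icc (t₁ / 2) π) := by
    refine continuousOn_const.div (by fun_prop) fun φ hφ => ?_
    have := hφ.1
    have : 0 < φ := by linarith
    positivity
  have hM_cont : ContinuousOn M (Set.Icc (t₁ / 2) π) := by fun_prop
  have hW_cont : ContinuousOn W (Set.Icc (t₁ / 2) π) := by fun_prop
  have hsW_ne : ∀ φ ∈ Set.Icc (t₁ / 2) π, √(W φ) ≠ 0 := fun φ hφ =>
    (Real.sqrt_pos.2 (hW_pos φ hφ)).ne'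
  have h_cont : ContinuousOn h (Set.Icc (t₁ / 2) π) := by
    refine (continuousOn_const.mul (continuous_arccot.comp_continuousOn ?_)).mul
      (hM_cont.div hW_cont.sqrt hsW_ne)
    exact ContinuousOn.div (by fun_prop) (hW_cont.sqrt.mul continuousOn_const)
      fun φ hφ => mul_ne_zero (hsW_ne φ hφ) hS.ne'
  have h_left : h (t₁ / 2) = 2 * θ - t₁ := by
    have hsW : √(W (t₁ / 2)) = M (t₁ / 2) := by
      simp only [W, hp_left]
      rw [one_pow, sub_self, zero_mul, zero_add, Real.sqrt_sq hM_left_pos.le]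
    have hcot : (Real.sin (t₁ / 2) + M (t₁ / 2) * Real.cos θ) / (M (t₁ / 2) * Real.sin θ) =
        Real.cos (θ - t₁ / 2) / Real.sin (θ - t₁ / 2) := by
      rw [← hM_left, div_eq_div_iff (by positivity) hM_left_pos.ne', hM_left, Real.sin_sub,
        Real.cos_sub]
      linear_combination (Real.sin (t₁ / 2)) *
        (Real.cos θ * Real.sin (t₁ / 2) - Real.sin θ * Real.cos (t₁ / 2)) *
        Real.sin_sq_add_cos_sq θ
    simp only [h]
    rw [hsW, hp_left, one_mul, hcot, arccot_cos_div_sin (by linarith) (by linarith),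
      div_self hM_left_pos.ne']
    ring
  have h_right : h π < 0 := by
    have := Real.sqrt_pos.2 (hW_pos π ⟨by linarith, le_rfl⟩)
    refine mul_neg_of_pos_of_neg (mul_pos two_pos (arccot_pos _)) (div_neg_of_neg_of_pos ?_ this)
    rw [hM_right]
    linarith
  obtain ⟨φ, ⟨hl, hr⟩, hφ⟩ := intermediate_value_Icc' (by linarith : t₁ / 2 ≤ π) h_cont
    (⟨by linarith, by linarith⟩ : t₂ ∈ Set.Icc (h π) (h (t₁ / 2)))
  have hl : t₁ / 2 < φ := hl.lt_of_ne (by rintro rfl; linarith)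
  have hr : φ < π := hr.lt_of_ne (by rintro rfl; linarith)
  have hφ0 : 0 < φ := by linarith
  have hsin : 0 < Real.sin φ := Real.sin_pos_of_pos_of_lt_pi hφ0 hr
  have hsW : 0 < √(W φ) := Real.sqrt_pos.2 (hW_pos φ ⟨hl.le, hr.le⟩)
  have hM : 0 < M φ := by
    by_contra! hM
    have : h φ ≤ 0 := mul_nonpos_of_nonneg_of_nonpos
      (mul_pos two_pos (arccot_pos _)).le (div_nonpos_of_nonpos_of_nonneg hM hsW.le)
    linarith
  have hp := hp0 φ hl.le
  have hk1 : 0 < 1 - p φ ^ 2 := by nlinarith [hp1 φ hl]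
  have hk : 0 < √(1 - p φ ^ 2) := Real.sqrt_pos.2 hk1
  have hk2 : √(1 - p φ ^ 2) ^ 2 = 1 - p φ ^ 2 := Real.sq_sqrt hk1.le
  have hsx : √(1 + (p φ / √(1 - p φ ^ 2)) ^ 2) = 1 / √(1 - p φ ^ 2) := by
    rw [Real.sqrt_eq_iff_mul_self_eq (by positivity) (by positivity)]
    field_simp
    rw [hk2]
    ring
  have hsy : √(1 + (M φ / (√(1 - p φ ^ 2) * Real.sin φ)) ^ 2) =
      √(W φ) / (√(1 - p φ ^ 2) * Real.sin φ) := by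
    rw [Real.sqrt_eq_iff_mul_self_eq (by positivity) (by positivity)]
    field_simp
    rw [hk2, Real.sq_sqrt (hW_pos φ ⟨hl.le, hr.le⟩).le]
  refine ⟨p φ / √(1 - p φ ^ 2), M φ / (√(1 - p φ ^ 2) * Real.sin φ), by positivity,
    by positivity, ?_, ?_⟩
  · rw [sideCurvature, hsx]
    have hcot : (M φ / (√(1 - p φ ^ 2) * Real.sin φ) + p φ / √(1 - p φ ^ 2) * Real.cos θ) /
        (1 / √(1 - p φ ^ 2) * Real.sin θ) = Real.cos φ / Real.sin φ := by
      field_simp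
      simp only [M]
      ring
    rw [hcot, arccot_cos_div_sin hφ0 hr]
    field_simp
    simp only [p]
    field_simp
  · rw [sideCurvature, hsy, ← hφ]
    have hcot : (p φ / √(1 - p φ ^ 2) + M φ / (√(1 - p φ ^ 2) * Real.sin φ) * Real.cos θ) /
        (√(W φ) / (√(1 - p φ ^ 2) * Real.sin φ) * Real.sin θ) =
        (p φ * Real.sin φ + M φ * Real.cos θ) / (√(W φ) * Real.sin θ) := by
      field_simp
    rw [hcot, div_div_div_cancel_right₀ (by positivity)]

/-- For any `θ ∈ (0, π)` and any `t₁, t₂ > 0` with `t₁ + t₂ < 2θ`, there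
exists a unique (up to isometry, i.e. a unique point of the moduli space `B_θ ≅ ℝ²` in the
coordinates `(K₁, K₂)`) spherical bigon of angle `θ` whose two sides have total geodesic
curvatures `t₁` and `t₂`. -/
theorem exists_unique_bigon_with_total_curvatures (θ t₁ t₂ : ℝ) (hθ : θ ∈ Set.Ioo 0 π)
    (ht₁ : 0 < t₁) (ht₂ : 0 < t₂) (hsum : t₁ + t₂ < 2 * θ) :
    ∃! K : ℝ × ℝ, T₁ θ K.1 K.2 = t₁ ∧ T₂ θ K.1 K.2 = t₂ := by
  have hS : 0 < Real.sin θ := Real.sin_pos_of_pos_of_lt_pi hθ.1 hθ.2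
  obtain ⟨x, y, hx, hy, h₁, h₂⟩ := exists_sideCurvature_eq hθ ht₁ ht₂ hsum
  refine ⟨(Real.log x, Real.log y), ?_, ?_⟩
  · simp only [T₂, T₁_eq_sideCurvature, Real.exp_log hx, Real.exp_log hy]
    exact ⟨h₁, h₂⟩
  · rintro ⟨K₁, K₂⟩ ⟨h₁', h₂'⟩
    simp only [T₂, T₁_eq_sideCurvature] at h₁' h₂'
    obtain ⟨rfl, rfl⟩ := sideCurvature_injective hS (Real.exp_pos K₁) (Real.exp_pos K₂) hx hy
      (h₁'.trans h₁.symm) (h₂'.trans h₂.symm)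
    simp only [Real.log_exp]
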